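/- arXiv:2102.11987 — 2 statements merged into one kernel-verified Lean document; each statement's English description precedes it below -/
import Mathlib

section
/- Let T > 0, let R1, R2 ≥ 0 and L1, L2 > 0 be reals, let i : [0,T] → ℝ be absolutely continuous, and let C1, C2, C3 : [0,T] → ℝ \ {0} be continuous functions. Define the 2×2 matrices A1 := [[(R1+R2)/L1, −R2/L1], [−R2/L2, (R1+R2)/L2]] and A2(t) := [[1/(L1 C1(t)) + 1/(L1 C3(t)), −1/(L1 C3(t))], [−1/(L2 C3(t)), 1/(L2 C2(t)) + 1/(L2 C3(t))]], and set C(t) := [i(t), +∞) × [0, +∞) ⊆ ℝ². Then for any initial condition x0 ∈ C(0), the differential inclusion −x'(t) ∈ N_{C(t)}(x(t)) + A1·x(t) + ∫_0^t [A2(t)·x(s) + (i(s)/(L1 C1(t)), 0)] ds for a.e. t ∈ [0,T], x(0) = x0, has one and only one absolutely continuous solution x : [0,T] → ℝ² with x(t) ∈ C(t) for all t ∈ [0,T]. -/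
open MeasureTheory Set
open scoped RealInnerProductSpace

noncomputable section

/-- The normal cone of convex analysis. -/
def convexNormalCone (S : Set (EuclideanSpace ℝ (Fin 2))) (x : EuclideanSpace ℝ (Fin 2)) : Set (EuclideanSpace ℝ (Fin 2)) :=
  {v | ∀ y ∈ S, ⟪v, y - x⟫ ≤ 0}

/-- The vector `(a, b)` of `ℝ²`. -/
def vec2 (a b : ℝ) : EuclideanSpace ℝ (Fin 2) := (WithLp.equiv 2 (Fin 2 → ℝ)).symm ![a, b]

/-- Absolutely continuous solution of the circuit integro-differential
sweeping process. -/
def IsCircuitSol (T R1 R2 L1 L2 : ℝ) (C1 C2 C3 i : ℝ → ℝ)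
    (x x' : ℝ → EuclideanSpace ℝ (Fin 2)) : Prop :=
  IntervalIntegrable x' volume 0 T ∧
  (∀ t ∈ Icc (0 : ℝ) T, x t = x 0 + ∫ s in (0 : ℝ)..t, x' s) ∧
  (∀ t ∈ Icc (0 : ℝ) T, i t ≤ x t 0 ∧ 0 ≤ x t 1) ∧
  (∀ᵐ t ∂volume, t ∈ Icc (0 : ℝ) T →
    (-x' t - vec2 ((R1 + R2) / L1 * x t 0 - R2 / L1 * x t 1)
        (-(R2 / L2) * x t 0 + (R1 + R2) / L2 * x t 1) -
      ∫ s in (0 : ℝ)..t,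
        (vec2 ((1 / (L1 * C1 t) + 1 / (L1 * C3 t)) * x s 0 - 1 / (L1 * C3 t) * x s 1)
            (-(1 / (L2 * C3 t)) * x s 0 + (1 / (L2 * C2 t) + 1 / (L2 * C3 t)) * x s 1) +
          vec2 (i s / (L1 * C1 t)) 0)) ∈
      convexNormalCone {p : EuclideanSpace ℝ (Fin 2) | i t ≤ p 0 ∧ 0 ≤ p 1} (x t))

lemma circ_sq_integral {T : ℝ} {d' : ℝ → ℝ} (h : IntervalIntegrable d' volume 0 T) {t : ℝ}
    (ht : t ∈ Icc (0 : ℝ) T) :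
    (∫ s in (0 : ℝ)..t, d' s) ^ 2 = ∫ s in (0 : ℝ)..t, 2 * ((∫ r in (0 : ℝ)..s, d' r) * d' s) := by
  have h' : IntervalIntegrable d' volume 0 t := h.mono_set (by
    rw [uIcc_of_le ht.1, uIcc_of_le (ht.1.trans ht.2)]; exact Icc_subset_Icc_right ht.2)
  have hac := h'.absolutelyContinuousOnInterval_intervalIntegral (c := 0) (by simp)
  have := hac.integral_deriv_mul_eq_sub hac
  simp only [intervalIntegral.integral_same, mul_zero, sub_zero] at this
  rw [sq, ← this]
  apply intervalIntegral.integral_congr_ae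
  filter_upwards [h'.ae_hasDerivAt_integral] with x hx hx3
  have := (hx (uIoc_subset_uIcc hx3) 0 (by simp)).deriv
  rw [this]; ring

/-- scalar sweeping process with moving half-line `[b t, ∞)` and drift `F`. -/
def ScalarSol (T : ℝ) (b F a a' : ℝ → ℝ) : Prop :=
  IntervalIntegrable a' volume 0 T ∧
  (∀ t ∈ Icc (0 : ℝ) T, a t = a 0 + ∫ s in (0 : ℝ)..t, a' s) ∧
  (∀ t ∈ Icc (0 : ℝ) T, b t ≤ a t) ∧
  (∀ᵐ t ∂volume, t ∈ Icc (0 : ℝ) T → ∀ p, b t ≤ p → (-a' t - F t) * (p - a t) ≤ 0)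

lemma circ_contOn {T : ℝ} (hT : 0 ≤ T) {a a' : ℝ → ℝ} (h : IntervalIntegrable a' volume 0 T)
    (h2 : ∀ t ∈ Icc (0 : ℝ) T, a t = a 0 + ∫ s in (0 : ℝ)..t, a' s) :
    ContinuousOn a (Icc 0 T) := by
  have hac := h.absolutelyContinuousOnInterval_intervalIntegral (c := 0) (by simp)
  have hc := hac.continuousOn
  rw [uIcc_of_le hT] at hc
  exact (continuousOn_const.add hc).congr h2

lemma circ_exp_int {l : ℝ} (hl : 0 < l) {t : ℝ} :
    ∫ s in (0 : ℝ)..t, Real.exp (l * s) = (Real.exp (l * t) - 1) / l := by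
  rw [intervalIntegral.integral_comp_mul_left (fun x => Real.exp x) hl.ne', integral_exp]
  simp; field_simp

lemma circ_stab {T : ℝ} (hT : 0 ≤ T) {b F G a a' c c' : ℝ → ℝ} {k l : ℝ} (hk : 0 ≤ k) (hl : 0 < l)
    (ha : ScalarSol T b F a a') (hc : ScalarSol T b G c c') (h0 : a 0 = c 0)
    (hFG : ∀ t ∈ Icc (0 : ℝ) T, |F t - G t| ≤ k * Real.exp (l * t)) :
    ∀ t ∈ Icc (0 : ℝ) T, |a t - c t| ≤ k / l * Real.exp (l * t) := by
  have hcont : ContinuousOn (fun t => Real.exp (-(l * t)) * |a t - c t|) (Icc 0 T) := by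
    have h1 := circ_contOn hT ha.1 ha.2.1
    have h2 := circ_contOn hT hc.1 hc.2.1
    have h3 : Continuous (fun t : ℝ => Real.exp (-(l * t))) := by fun_prop
    exact h3.continuousOn.mul (h1.sub h2).abs
  obtain ⟨τ, hτ, hmax⟩ := isCompact_Icc.exists_isMaxOn (nonempty_Icc.2 hT) hcont
  set W := Real.exp (-(l * τ)) * |a τ - c τ| with hW
  have hW0 : 0 ≤ W := by positivity
  have hb : ∀ t ∈ Icc (0 : ℝ) T, |a t - c t| ≤ W * Real.exp (l * t) := by
    intro t ht
    have : Real.exp (-(l * t)) * |a t - c t| ≤ W := hmax ht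
    rw [Real.exp_neg, inv_mul_le_iff₀ (Real.exp_pos _)] at this
    linarith
  have hd : IntervalIntegrable (fun s => a' s - c' s) volume 0 T := ha.1.sub hc.1
  have hsub : ∀ t ∈ Icc (0 : ℝ) T, uIcc 0 t ⊆ uIcc 0 T := fun t ht => by
    rw [uIcc_of_le ht.1, uIcc_of_le (ht.1.trans ht.2)]; exact Icc_subset_Icc_right ht.2
  have hdeq : ∀ t ∈ Icc (0 : ℝ) T, a t - c t = ∫ s in (0 : ℝ)..t, (a' s - c' s) := by
    intro t ht
    rw [intervalIntegral.integral_sub (ha.1.mono_set (hsub t ht)) (hc.1.mono_set (hsub t ht)),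
      ha.2.1 t ht, hc.2.1 t ht, h0]; ring
  have hkey : (a τ - c τ) ^ 2 ≤ 2 * k * W * ((Real.exp (2 * l * τ) - 1) / (2 * l)) := by
    rw [hdeq τ hτ, circ_sq_integral hd hτ, ← circ_exp_int (by positivity : 0 < 2 * l),
      ← intervalIntegral.integral_const_mul]
    apply intervalIntegral.integral_mono_ae_restrict hτ.1
    · have hD := (hd.mono_set (hsub τ hτ)).absolutelyContinuousOnInterval_intervalIntegral (c := 0) (by simp)
      exact ((hd.mono_set (hsub τ hτ)).continuousOn_mul hD.continuousOn).const_mul 2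
    · exact Continuous.intervalIntegrable (by fun_prop) _ _
    · rw [Filter.EventuallyLE, ae_restrict_iff' measurableSet_Icc]
      filter_upwards [ha.2.2.2, hc.2.2.2] with s h1 h2 hs
      have hs' : s ∈ Icc (0 : ℝ) T := ⟨hs.1, hs.2.trans hτ.2⟩
      have e1 := h1 hs' (c s) (hc.2.2.1 s hs')
      have e2 := h2 hs' (a s) (ha.2.2.1 s hs')
      have e3 := hFG s hs'
      have e4 := hb s hs'
      rw [← hdeq s hs']
      have e5 : (a s - c s) * (a' s - c' s) ≤ |F s - G s| * |a s - c s| := by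
        have : -((F s - G s) * (a s - c s)) ≤ |F s - G s| * |a s - c s| := by
          rw [← abs_mul]; exact neg_le_abs _
        nlinarith
      have e6 : |F s - G s| * |a s - c s| ≤ (k * Real.exp (l * s)) * (W * Real.exp (l * s)) := by
        gcongr
      have e7 : Real.exp (2 * l * s) = Real.exp (l * s) * Real.exp (l * s) := by
        rw [← Real.exp_add]; ring_nf
      rw [e7]
      nlinarith
  have hWle : W ≤ k / l := by
    have e1 : W ^ 2 ≤ k / l * W := by
      have e2 : W ^ 2 = Real.exp (-(2 * l * τ)) * (a τ - c τ) ^ 2 := by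
        rw [hW, mul_pow, sq_abs, ← Real.exp_nat_mul]; congr 2; push_cast; ring
      rw [e2]
      calc _ ≤ Real.exp (-(2 * l * τ)) * (2 * k * W * ((Real.exp (2 * l * τ)) / (2 * l))) := by
            gcongr
            refine hkey.trans ?_
            gcongr
            linarith
        _ = k / l * W := by
            rw [Real.exp_neg]
            have := Real.exp_pos (2 * l * τ)
            field_simp
    rcases hW0.eq_or_lt with h | h
    · rw [← h]; positivity
    · nlinarith
  intro t ht
  exact (hb t ht).trans (by gcongr)

lemma circ_reflect {T : ℝ} (hT : 0 ≤ T) {g g' : ℝ → ℝ} (hg' : IntervalIntegrable g' volume 0 T)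
    (hg : ∀ t ∈ Icc (0 : ℝ) T, g t = g 0 + ∫ s in (0 : ℝ)..t, g' s) (hg0 : g 0 ≤ 0) :
    ∃ k' : ℝ → ℝ, IntervalIntegrable k' volume 0 T ∧
      (∀ t ∈ Icc (0 : ℝ) T, g t ≤ ∫ s in (0 : ℝ)..t, k' s) ∧
      (∀ᵐ t ∂volume, t ∈ Icc (0 : ℝ) T →
        0 ≤ k' t ∧ (g t < ∫ s in (0 : ℝ)..t, k' s → k' t = 0)) := by
  have hgc := circ_contOn hT hg' hg
  have hsub : ∀ s ∈ Icc (0 : ℝ) T, ∀ t ∈ Icc (0 : ℝ) T, uIcc s t ⊆ uIcc 0 T := fun s hs t ht => by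
    rw [uIcc_of_le hT]; exact uIcc_subset_Icc hs ht
  set h : ℝ → ℝ := fun t => max (g t) 0 with hh
  have hhc : ContinuousOn h (Icc 0 T) := (continuous_id.max continuous_const).comp_continuousOn hgc
  -- the running maximum
  have hex : ∀ t, ∃ m, t ∈ Icc (0 : ℝ) T → (∃ r ∈ Icc 0 t, h r = m) ∧ ∀ r ∈ Icc 0 t, h r ≤ m := by
    intro t
    by_cases ht : t ∈ Icc (0 : ℝ) T
    · obtain ⟨r, hr, hm⟩ := isCompact_Icc.exists_isMaxOn (nonempty_Icc.2 ht.1)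
        (hhc.mono (Icc_subset_Icc_right ht.2))
      exact ⟨h r, fun _ => ⟨⟨r, hr, rfl⟩, fun q hq => hm hq⟩⟩
    · exact ⟨0, fun hh => absurd hh ht⟩
  choose M hM using hex
  have hM0 : M 0 = 0 := by
    obtain ⟨⟨r, hr, he⟩, -⟩ := hM 0 ⟨le_rfl, hT⟩
    have : r = 0 := le_antisymm hr.2 hr.1
    subst this
    rw [← he]; simp [hh, hg0]
  have hmono : ∀ s ∈ Icc (0 : ℝ) T, ∀ t ∈ Icc (0 : ℝ) T, s ≤ t → M s ≤ M t := by
    intro s hs t ht hst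
    obtain ⟨⟨r, hr, he⟩, -⟩ := hM s hs
    rw [← he]
    exact (hM t ht).2 r ⟨hr.1, hr.2.trans hst⟩
  have habs : IntervalIntegrable (fun s => |g' s|) volume 0 T := hg'.abs
  set G : ℝ → ℝ := fun t => ∫ s in (0 : ℝ)..t, |g' s| with hG
  have hGsub : ∀ s ∈ Icc (0 : ℝ) T, ∀ t ∈ Icc (0 : ℝ) T, G t - G s = ∫ r in s..t, |g' r| := by
    intro s hs t ht
    exact intervalIntegral.integral_interval_sub_left
      (habs.mono_set (hsub 0 ⟨le_rfl, hT⟩ t ht)) (habs.mono_set (hsub 0 ⟨le_rfl, hT⟩ s hs))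
  have hGmono : ∀ s ∈ Icc (0 : ℝ) T, ∀ t ∈ Icc (0 : ℝ) T, s ≤ t → G s ≤ G t := by
    intro s hs t ht hst
    have := hGsub s hs t ht
    have h2 : 0 ≤ ∫ r in s..t, |g' r| :=
      intervalIntegral.integral_nonneg hst (fun _ _ => abs_nonneg _)
    linarith
  have hhG : ∀ s ∈ Icc (0 : ℝ) T, ∀ t ∈ Icc (0 : ℝ) T, s ≤ t → h t - h s ≤ G t - G s := by
    intro s hs t ht hst
    have e1 : g t - g s = ∫ r in s..t, g' r := by
      rw [hg t ht, hg s hs, ← intervalIntegral.integral_interval_sub_left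
        (hg'.mono_set (hsub 0 ⟨le_rfl, hT⟩ t ht)) (hg'.mono_set (hsub 0 ⟨le_rfl, hT⟩ s hs))]
      ring
    have e2 : |g t - g s| ≤ G t - G s := by
      rw [e1, hGsub s hs t ht]
      exact intervalIntegral.abs_integral_le_integral_abs hst
    have e3 : |h t - h s| ≤ |g t - g s| := abs_max_sub_max_le_abs _ _ _
    exact (le_abs_self _).trans (e3.trans e2)
  have hMG : ∀ s ∈ Icc (0 : ℝ) T, ∀ t ∈ Icc (0 : ℝ) T, s ≤ t → M t - M s ≤ G t - G s := by
    intro s hs t ht hst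
    obtain ⟨⟨r, hr, he⟩, -⟩ := hM t ht
    rcases le_total r s with h1 | h1
    · have := (hM s hs).2 r ⟨hr.1, h1⟩
      have := hGmono s hs t ht hst
      linarith
    · have hr' : r ∈ Icc (0 : ℝ) T := ⟨hr.1, hr.2.trans ht.2⟩
      have e1 := hhG s hs r hr' h1
      have e2 := hGmono r hr' t ht hr.2
      have e3 := (hM s hs).2 s ⟨hs.1, le_rfl⟩
      linarith
  have hMGd : ∀ s ∈ Icc (0 : ℝ) T, ∀ t ∈ Icc (0 : ℝ) T, dist (M s) (M t) ≤ dist (G s) (G t) := by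
    have key : ∀ s ∈ Icc (0 : ℝ) T, ∀ t ∈ Icc (0 : ℝ) T, s ≤ t →
        dist (M s) (M t) ≤ dist (G s) (G t) := by
      intro s hs t ht hst
      rw [dist_comm, dist_comm (G s), Real.dist_eq, Real.dist_eq,
        abs_of_nonneg (sub_nonneg.2 (hmono s hs t ht hst)),
        abs_of_nonneg (sub_nonneg.2 (hGmono s hs t ht hst))]
      exact hMG s hs t ht hst
    intro s hs t ht
    rcases le_total s t with h1 | h1
    · exact key s hs t ht h1
    · rw [dist_comm, dist_comm (G s)]; exact key t ht s hs h1
  have hGac : AbsolutelyContinuousOnInterval G 0 T :=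
    habs.absolutelyContinuousOnInterval_intervalIntegral (c := 0) (by simp)
  have hMac : AbsolutelyContinuousOnInterval M 0 T := by
    rw [absolutelyContinuousOnInterval_iff] at hGac ⊢
    intro ε hε
    obtain ⟨δ, hδ, hE⟩ := hGac ε hε
    refine ⟨δ, hδ, fun E hE1 hE2 => lt_of_le_of_lt (Finset.sum_le_sum fun j hj => ?_) (hE E hE1 hE2)⟩
    have := hE1.1 j hj
    rw [uIcc_of_le hT] at this
    exact hMGd _ this.1 _ this.2
  have hint : ∀ t ∈ Icc (0 : ℝ) T, ∫ s in (0 : ℝ)..t, deriv M s = M t := by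
    intro t ht
    rw [(hMac.mono (hsub 0 ⟨le_rfl, hT⟩ t ht)).integral_deriv_eq_sub, hM0, sub_zero]
  refine ⟨deriv M, hMac.intervalIntegrable_deriv, fun t ht => ?_, ?_⟩
  · rw [hint t ht]
    exact (le_max_left _ _).trans ((hM t ht).2 t ⟨ht.1, le_rfl⟩)
  · have h₁ : ∀ᵐ x : ℝ, x ≠ 0 := by simp [ae_iff, measure_singleton]
    have h₂ : ∀ᵐ x : ℝ, x ≠ T := by simp [ae_iff, measure_singleton]
    filter_upwards [h₁, h₂] with t ht0 htT ht
    have htI : t ∈ Ioo (0 : ℝ) T := ⟨lt_of_le_of_ne ht.1 (Ne.symm ht0), lt_of_le_of_ne ht.2 htT⟩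
    have hnhds : Icc (0 : ℝ) T ∈ nhds t := Icc_mem_nhds htI.1 htI.2
    refine ⟨?_, ?_⟩
    · rw [← derivWithin_of_mem_nhds hnhds]
      exact MonotoneOn.derivWithin_nonneg (fun s hs t ht hst => hmono s hs t ht hst)
    · rw [hint t ht]
      intro hlt
      rcases (hM t ht).1 with ⟨r, hr, hre⟩
      have hMnn : 0 ≤ M t := by rw [← hre]; exact le_max_right _ _
      rcases hMnn.eq_or_lt with hz | hpos
      · -- the running maximum is still zero: `g t < 0`
        have hev : ∀ᶠ s in nhds t, g s < M t :=
          (hgc.continuousAt hnhds).eventually (gt_mem_nhds hlt)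
        obtain ⟨ε, hε, hball⟩ := Metric.mem_nhds_iff.1 (Filter.inter_mem hev hnhds)
        have hconst : M =ᶠ[nhds t] fun _ => M t := by
          filter_upwards [Metric.ball_mem_nhds t hε] with s hs
          have hsI := (hball hs).2
          have hs0 : 0 ≤ M s := by rw [← hM0]; exact hmono 0 ⟨le_rfl, hT⟩ s hsI hsI.1
          rcases le_total s t with h1 | h1
          · have := hmono s hsI t ht h1
            linarith
          · obtain ⟨⟨q, hq, hqe⟩, -⟩ := hM s hsI
            rcases le_total q t with h2 | h2
            · have := (hM t ht).2 q ⟨hq.1, h2⟩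
              linarith
            · have hqb : q ∈ Metric.ball t ε := by
                rw [Metric.mem_ball, Real.dist_eq, abs_lt] at hs ⊢
                exact ⟨by linarith, by linarith [hq.2]⟩
              have h3 : g q < M t := (hball hqb).1
              have : h q = 0 := max_eq_right (by linarith)
              linarith
        rw [hconst.deriv_eq]; simp
      · have hlt' : h t < M t := max_lt hlt hpos
        have hev : ∀ᶠ s in nhds t, h s < M t :=
          (hhc.continuousAt hnhds).eventually (gt_mem_nhds hlt')
        obtain ⟨ε, hε, hball⟩ := Metric.mem_nhds_iff.1 (Filter.inter_mem hev hnhds)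
        have hconst : M =ᶠ[nhds t] fun _ => M t := by
          filter_upwards [Metric.ball_mem_nhds t hε] with s hs
          have hsI := (hball hs).2
          rcases le_total s t with h1 | h1
          · refine le_antisymm (hmono s hsI t ht h1) ?_
            rcases le_total r s with h2 | h2
            · rw [← hre]; exact (hM s hsI).2 r ⟨hr.1, h2⟩
            · have hrb : r ∈ Metric.ball t ε := by
                rw [Metric.mem_ball, Real.dist_eq, abs_lt] at hs ⊢
                exact ⟨by linarith, by linarith [hr.2]⟩
              have h3 : h r < M t := (hball hrb).1
              linarith
          · refine le_antisymm ?_ (hmono t ht s hsI h1)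
            obtain ⟨⟨q, hq, hqe⟩, -⟩ := hM s hsI
            rcases le_total q t with h2 | h2
            · have := (hM t ht).2 q ⟨hq.1, h2⟩
              linarith
            · have hqb : q ∈ Metric.ball t ε := by
                rw [Metric.mem_ball, Real.dist_eq, abs_lt] at hs ⊢
                exact ⟨by linarith, by linarith [hq.2]⟩
              have h3 : h q < M t := (hball hqb).1
              linarith
        rw [hconst.deriv_eq]; simp

lemma circ_scalar_exists {T : ℝ} (hT : 0 ≤ T) {b b' F : ℝ → ℝ} (hb' : IntervalIntegrable b' volume 0 T)
    (hb : ∀ t ∈ Icc (0 : ℝ) T, b t = b 0 + ∫ s in (0 : ℝ)..t, b' s)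
    (hF : ContinuousOn F (Icc 0 T)) (a0 : ℝ) (ha0 : b 0 ≤ a0) :
    ∃ a a' : ℝ → ℝ, a 0 = a0 ∧ ScalarSol T b F a a' := by
  have hFi : IntervalIntegrable F volume 0 T := by
    apply ContinuousOn.intervalIntegrable; rwa [uIcc_of_le hT]
  have hsub : ∀ t ∈ Icc (0 : ℝ) T, uIcc 0 t ⊆ uIcc 0 T := fun t ht => by
    rw [uIcc_of_le ht.1, uIcc_of_le hT]; exact Icc_subset_Icc_right ht.2
  obtain ⟨k', hk', hk1, hk2⟩ := circ_reflect hT (g := fun t => b t - a0 + ∫ s in (0 : ℝ)..t, F s)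
    (g' := fun t => b' t + F t) (hb'.add hFi) (by
      intro t ht
      rw [intervalIntegral.integral_add (hb'.mono_set (hsub t ht)) (hFi.mono_set (hsub t ht)), hb t ht]
      simp; ring) (by simp [ha0])
  refine ⟨fun t => a0 + ∫ s in (0 : ℝ)..t, (k' s - F s), fun t => k' t - F t, by simp,
    hk'.sub hFi, fun t ht => by simp, ?_, ?_⟩
  · intro t ht
    have := hk1 t ht
    beta_reduce
    rw [intervalIntegral.integral_sub (hk'.mono_set (hsub t ht)) (hFi.mono_set (hsub t ht))]
    linarith
  · filter_upwards [hk2] with t h2 ht p hp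
    obtain ⟨h3, h4⟩ := h2 ht
    have := hk1 t ht
    beta_reduce
    rw [intervalIntegral.integral_sub (hk'.mono_set (hsub t ht)) (hFi.mono_set (hsub t ht))]
    rcases this.eq_or_lt with h5 | h5
    · have : 0 ≤ p - (a0 + ((∫ s in (0 : ℝ)..t, k' s) - ∫ s in (0 : ℝ)..t, F s)) := by linarith
      nlinarith
    · rw [h4 h5]; simp

/-- linear Volterra drift -/
def circDrift (α : Fin 2 → Fin 2 → ℝ) (β : ℝ → Fin 2 → Fin 2 → ℝ) (γ : ℝ → Fin 2 → ℝ)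
    (a : Fin 2 → ℝ → ℝ) (j : Fin 2) (t : ℝ) : ℝ :=
  ∑ k, α j k * a k t + ∑ k, β t j k * (∫ s in (0 : ℝ)..t, a k s) + γ t j

lemma circ_drift_lip {T : ℝ} {α : Fin 2 → Fin 2 → ℝ} {β : ℝ → Fin 2 → Fin 2 → ℝ}
    {γ : ℝ → Fin 2 → ℝ} {K l W : ℝ} (hK : 0 ≤ K) (hl : 1 ≤ l) (hW : 0 ≤ W)
    (hα : ∀ j k, |α j k| ≤ K) (hβ : ∀ t ∈ Icc (0 : ℝ) T, ∀ j k, |β t j k| ≤ K)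
    {a c : Fin 2 → ℝ → ℝ} (ha : ∀ j, ContinuousOn (a j) (Icc 0 T))
    (hc : ∀ j, ContinuousOn (c j) (Icc 0 T))
    (hac : ∀ j, ∀ t ∈ Icc (0 : ℝ) T, |a j t - c j t| ≤ W * Real.exp (l * t)) (j : Fin 2) :
    ∀ t ∈ Icc (0 : ℝ) T, |circDrift α β γ a j t - circDrift α β γ c j t|
      ≤ 4 * K * W * Real.exp (l * t) := by
  intro t ht
  have hii : ∀ f : ℝ → ℝ, ContinuousOn f (Icc 0 T) → IntervalIntegrable f volume 0 t := by
    intro f hf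
    apply ContinuousOn.intervalIntegrable
    rw [uIcc_of_le ht.1]; exact hf.mono (Icc_subset_Icc_right ht.2)
  have hI : ∀ k, |(∫ s in (0 : ℝ)..t, a k s) - ∫ s in (0 : ℝ)..t, c k s| ≤ W * Real.exp (l * t) := by
    intro k
    rw [← intervalIntegral.integral_sub (hii _ (ha k)) (hii _ (hc k))]
    calc _ ≤ ∫ s in (0 : ℝ)..t, |a k s - c k s| := intervalIntegral.abs_integral_le_integral_abs ht.1
      _ ≤ ∫ s in (0 : ℝ)..t, W * Real.exp (l * s) := by
          apply intervalIntegral.integral_mono_on ht.1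
          · exact hii _ ((ha k).sub (hc k)).abs
          · exact Continuous.intervalIntegrable (by fun_prop) _ _
          · intro s hs; exact hac k s ⟨hs.1, hs.2.trans ht.2⟩
      _ = W * ((Real.exp (l * t) - 1) / l) := by
          rw [intervalIntegral.integral_const_mul, circ_exp_int (by linarith)]
      _ ≤ W * Real.exp (l * t) := by
          gcongr
          rw [div_le_iff₀ (by linarith)]
          nlinarith [Real.exp_pos (l * t)]
  have e : circDrift α β γ a j t - circDrift α β γ c j t =
      ∑ k, (α j k * (a k t - c k t) +
        β t j k * ((∫ s in (0 : ℝ)..t, a k s) - ∫ s in (0 : ℝ)..t, c k s)) := by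
    simp only [circDrift, Fin.sum_univ_two]; ring
  rw [e]
  calc _ ≤ ∑ k : Fin 2, |α j k * (a k t - c k t) +
        β t j k * ((∫ s in (0 : ℝ)..t, a k s) - ∫ s in (0 : ℝ)..t, c k s)| :=
        Finset.abs_sum_le_sum_abs _ _
    _ ≤ ∑ k : Fin 2, (K * (W * Real.exp (l * t)) + K * (W * Real.exp (l * t))) := by
        apply Finset.sum_le_sum
        intro k _
        refine (abs_add_le _ _).trans ?_
        rw [abs_mul, abs_mul]
        exact add_le_add
          (mul_le_mul (hα j k) (hac k t ht) (abs_nonneg _) hK)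
          (mul_le_mul (hβ t ht j k) (hI k) (abs_nonneg _) hK)
    _ = 4 * K * W * Real.exp (l * t) := by rw [Fin.sum_univ_two]; ring

lemma circ_drift_cont {T : ℝ} (hT : 0 ≤ T) {α : Fin 2 → Fin 2 → ℝ} {β : ℝ → Fin 2 → Fin 2 → ℝ}
    {γ : ℝ → Fin 2 → ℝ} (hβ : ∀ j k, ContinuousOn (fun t => β t j k) (Icc 0 T))
    (hγ : ∀ j, ContinuousOn (fun t => γ t j) (Icc 0 T))
    {a : Fin 2 → ℝ → ℝ} (ha : ∀ j, ContinuousOn (a j) (Icc 0 T)) (j : Fin 2) :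
    ContinuousOn (circDrift α β γ a j) (Icc 0 T) := by
  have hI : ∀ k, ContinuousOn (fun t => ∫ s in (0 : ℝ)..t, a k s) (Icc 0 T) := by
    intro k
    have h : IntervalIntegrable (a k) volume 0 T := by
      apply ContinuousOn.intervalIntegrable; rw [uIcc_of_le hT]; exact ha k
    have := (h.absolutelyContinuousOnInterval_intervalIntegral (c := 0) (by simp)).continuousOn
    rwa [uIcc_of_le hT] at this
  unfold circDrift
  refine ((continuousOn_finsetSum _ fun k _ => ?_).add
    (continuousOn_finsetSum _ fun k _ => ?_)).add (hγ j)
  · exact continuousOn_const.mul (ha k)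
  · exact (hβ j k).mul (hI k)

lemma circ_bound {T : ℝ} {α : Fin 2 → Fin 2 → ℝ} {β : ℝ → Fin 2 → Fin 2 → ℝ}
    (hβ : ∀ j k, ContinuousOn (fun t => β t j k) (Icc 0 T)) :
    ∃ K : ℝ, 0 ≤ K ∧ (∀ j k, |α j k| ≤ K) ∧ (∀ t ∈ Icc (0 : ℝ) T, ∀ j k, |β t j k| ≤ K) := by
  have : ∀ j k, ∃ B, ∀ t ∈ Icc (0 : ℝ) T, |β t j k| ≤ B := fun j k =>
    isCompact_Icc.exists_bound_of_continuousOn (hβ j k)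
  choose B hB using this
  have hs : ∀ f : Fin 2 → Fin 2 → ℝ, ∀ j k, |f j k| ≤ ∑ j, ∑ k, |f j k| := by
    intro f j k
    refine (Finset.single_le_sum (f := fun k => |f j k|) (fun _ _ => abs_nonneg _)
      (Finset.mem_univ k)).trans ?_
    exact Finset.single_le_sum (f := fun j => ∑ k, |f j k|)
      (fun _ _ => Finset.sum_nonneg fun _ _ => abs_nonneg _) (Finset.mem_univ j)
  have hn : ∀ f : Fin 2 → Fin 2 → ℝ, 0 ≤ ∑ j, ∑ k, |f j k| := fun f =>
    Finset.sum_nonneg fun _ _ => Finset.sum_nonneg fun _ _ => abs_nonneg _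
  refine ⟨(∑ j, ∑ k, |α j k|) + ∑ j, ∑ k, |B j k|, add_nonneg (hn _) (hn _), ?_, ?_⟩
  · intro j k; linarith [hs α j k, hn B]
  · intro t ht j k; linarith [hs B j k, hn α, hB j k t ht, le_abs_self (B j k)]

lemma circ_system_unique {T : ℝ} (hT : 0 ≤ T) {α : Fin 2 → Fin 2 → ℝ} {β : ℝ → Fin 2 → Fin 2 → ℝ}
    {γ : ℝ → Fin 2 → ℝ} (hβ : ∀ j k, ContinuousOn (fun t => β t j k) (Icc 0 T))
    {b a a' c c' : Fin 2 → ℝ → ℝ} (h0 : ∀ j, a j 0 = c j 0)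
    (ha : ∀ j, ScalarSol T (b j) (circDrift α β γ a j) (a j) (a' j))
    (hc : ∀ j, ScalarSol T (b j) (circDrift α β γ c j) (c j) (c' j)) :
    ∀ j, ∀ t ∈ Icc (0 : ℝ) T, a j t = c j t := by
  obtain ⟨K, hK, hα, hβK⟩ := circ_bound (α := α) hβ
  have hac : ∀ j, ContinuousOn (a j) (Icc 0 T) := fun j => circ_contOn hT (ha j).1 (ha j).2.1
  have hcc : ∀ j, ContinuousOn (c j) (Icc 0 T) := fun j => circ_contOn hT (hc j).1 (hc j).2.1
  set l := 16 * K + 1 with hl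
  have hcont : ContinuousOn (fun t => Real.exp (-(l * t)) * (|a 0 t - c 0 t| + |a 1 t - c 1 t|))
      (Icc 0 T) := by
    have h3 : Continuous (fun t : ℝ => Real.exp (-(l * t))) := by fun_prop
    exact h3.continuousOn.mul (((hac 0).sub (hcc 0)).abs.add ((hac 1).sub (hcc 1)).abs)
  obtain ⟨τ, hτ, hmax⟩ := isCompact_Icc.exists_isMaxOn (nonempty_Icc.2 hT) hcont
  set W := Real.exp (-(l * τ)) * (|a 0 τ - c 0 τ| + |a 1 τ - c 1 τ|) with hW
  have hW0 : 0 ≤ W := by positivity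
  have hsum : ∀ t ∈ Icc (0 : ℝ) T, |a 0 t - c 0 t| + |a 1 t - c 1 t| ≤ W * Real.exp (l * t) := by
    intro t ht
    have : Real.exp (-(l * t)) * (|a 0 t - c 0 t| + |a 1 t - c 1 t|) ≤ W := hmax ht
    rw [Real.exp_neg, inv_mul_le_iff₀ (Real.exp_pos _)] at this
    linarith
  have hb : ∀ j, ∀ t ∈ Icc (0 : ℝ) T, |a j t - c j t| ≤ W * Real.exp (l * t) := by
    intro j t ht
    have := hsum t ht
    have h1 := abs_nonneg (a 0 t - c 0 t)
    have h2 := abs_nonneg (a 1 t - c 1 t)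
    fin_cases j
    · simp only [Fin.zero_eta]; linarith
    · simp only [Fin.mk_one]; linarith
  have hst : ∀ j, |a j τ - c j τ| ≤ 4 * K * W / l * Real.exp (l * τ) := fun j =>
    circ_stab hT (by positivity) (by positivity) (ha j) (hc j) (h0 j)
      (circ_drift_lip hK (by linarith) hW0 hα hβK hac hcc hb j) τ hτ
  have hWz : W ≤ W / 2 := by
    have h1 : W ≤ 8 * K * W / l := by
      rw [hW, Real.exp_neg, inv_mul_le_iff₀ (Real.exp_pos _), ← Real.exp_neg, ← hW]
      have := hst 0
      have := hst 1
      have e : Real.exp (l * τ) * (8 * K * W / l) = 2 * (4 * K * W / l * Real.exp (l * τ)) := by ring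
      linarith
    refine h1.trans ?_
    rw [div_le_iff₀ (by positivity)]
    nlinarith
  have hWz : W = 0 := by linarith
  intro j t ht
  have := hb j t ht
  rw [hWz, zero_mul] at this
  exact sub_eq_zero.1 (abs_eq_zero.1 (le_antisymm this (abs_nonneg _)))

lemma circ_system_exists {T : ℝ} (hT : 0 ≤ T) {α : Fin 2 → Fin 2 → ℝ} {β : ℝ → Fin 2 → Fin 2 → ℝ}
    {γ : ℝ → Fin 2 → ℝ} (hβ : ∀ j k, ContinuousOn (fun t => β t j k) (Icc 0 T))
    (hγ : ∀ j, ContinuousOn (fun t => γ t j) (Icc 0 T))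
    {b b' : Fin 2 → ℝ → ℝ} (hb' : ∀ j, IntervalIntegrable (b' j) volume 0 T)
    (hb : ∀ j, ∀ t ∈ Icc (0 : ℝ) T, b j t = b j 0 + ∫ s in (0 : ℝ)..t, b' j s)
    (x0 : Fin 2 → ℝ) (hx0 : ∀ j, b j 0 ≤ x0 j) :
    ∃ a a' : Fin 2 → ℝ → ℝ, (∀ j, a j 0 = x0 j) ∧
      ∀ j, ScalarSol T (b j) (circDrift α β γ a j) (a j) (a' j) := by
  obtain ⟨K, hK, hα, hβK⟩ := circ_bound (α := α) hβ
  set l := 16 * K + 1 with hl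
  let A : C(Icc (0 : ℝ) T, Fin 2 → ℝ) → Fin 2 → ℝ → ℝ := fun z j t =>
    Real.exp (l * t) * z (projIcc 0 T hT t) j
  have hA : ∀ z j, Continuous (A z j) := by
    intro z j
    have h1 : Continuous (fun t : ℝ => Real.exp (l * t)) := by fun_prop
    have h2 : Continuous (fun t : ℝ => z (projIcc 0 T hT t)) := z.continuous.comp continuous_projIcc
    exact h1.mul ((continuous_apply j).comp h2)
  have hex : ∀ z j, ∃ a a' : ℝ → ℝ, a 0 = x0 j ∧ ScalarSol T (b j) (circDrift α β γ (A z) j) a a' :=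
    fun z j => circ_scalar_exists hT (hb' j) (hb j)
      (circ_drift_cont hT hβ hγ (fun k => (hA z k).continuousOn) j) (x0 j) (hx0 j)
  choose S S' hS0 hS using hex
  let Ψ : C(Icc (0 : ℝ) T, Fin 2 → ℝ) → C(Icc (0 : ℝ) T, Fin 2 → ℝ) := fun z =>
    ⟨fun t j => Real.exp (-(l * t)) * S z j t, by
      refine continuous_pi fun j => ?_
      have h1 : Continuous (fun t : Icc (0 : ℝ) T => Real.exp (-(l * (t : ℝ)))) := by fun_prop
      exact h1.mul (continuousOn_iff_continuous_domRestrict.1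
        (circ_contOn hT (hS z j).1 (hS z j).2.1))⟩
  have hΨ : ContractingWith (1 / 2) Ψ := by
    refine ⟨by norm_num, LipschitzWith.of_dist_le_mul fun z w => ?_⟩
    have hW0 : 0 ≤ dist z w := dist_nonneg
    rw [ContinuousMap.dist_le (by positivity)]
    intro t
    rw [dist_pi_le_iff (by positivity)]
    intro j
    have hzw : ∀ k, ∀ s ∈ Icc (0 : ℝ) T, |A z k s - A w k s| ≤ dist z w * Real.exp (l * s) := by
      intro k s _
      have h1 := (dist_le_pi_dist _ _ k).trans
        (ContinuousMap.dist_apply_le_dist (f := z) (g := w) (projIcc 0 T hT s))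
      rw [Real.dist_eq] at h1
      simp only [A]
      rw [← mul_sub, abs_mul, abs_of_pos (Real.exp_pos _), mul_comm]
      gcongr
    have h2 := circ_stab hT (by positivity) (by positivity) (hS z j) (hS w j)
      ((hS0 z j).trans (hS0 w j).symm)
      (circ_drift_lip hK (by linarith) hW0 hα hβK (fun k => (hA z k).continuousOn)
        (fun k => (hA w k).continuousOn) hzw j) t t.2
    have h3 : dist (Ψ z t j) (Ψ w t j) ≤ 4 * K * dist z w / l := by
      simp only [Ψ, ContinuousMap.coe_mk, Real.dist_eq]
      rw [← mul_sub, abs_mul, abs_of_pos (Real.exp_pos _), Real.exp_neg,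
        inv_mul_le_iff₀ (Real.exp_pos _), mul_comm]
      exact h2
    refine h3.trans ?_
    rw [div_le_iff₀ (by positivity)]
    push_cast
    nlinarith
  have hfix : Ψ (hΨ.fixedPoint Ψ) = hΨ.fixedPoint Ψ := hΨ.fixedPoint_isFixedPt
  set z := hΨ.fixedPoint Ψ
  have hEq : ∀ k, ∀ t ∈ Icc (0 : ℝ) T, A z k t = S z k t := by
    intro k t ht
    have h1 : Ψ z ⟨t, ht⟩ k = z ⟨t, ht⟩ k := by rw [hfix]
    simp only [A]
    rw [projIcc_of_mem hT ht, ← h1]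
    simp only [Ψ, ContinuousMap.coe_mk]
    rw [← mul_assoc, ← Real.exp_add]; simp
  refine ⟨S z, S' z, hS0 z, fun j => ?_⟩
  obtain ⟨s1, s2, s3, s4⟩ := hS z j
  refine ⟨s1, s2, s3, ?_⟩
  filter_upwards [s4] with t h ht
  have hD : circDrift α β γ (S z) j t = circDrift α β γ (A z) j t := by
    unfold circDrift
    congr 2
    · exact Finset.sum_congr rfl fun k _ => by rw [hEq k t ht]
    · refine Finset.sum_congr rfl fun k _ => ?_
      congr 1
      apply intervalIntegral.integral_congr
      intro s hs
      rw [uIcc_of_le ht.1] at hs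
      exact (hEq k s ⟨hs.1, hs.2.trans ht.2⟩).symm
  rw [hD]
  exact h ht

@[simp] lemma vec2_zero (a b : ℝ) : vec2 a b 0 = a := rfl
@[simp] lemma vec2_one (a b : ℝ) : vec2 a b 1 = b := rfl

lemma circ_inner (v w : EuclideanSpace ℝ (Fin 2)) : ⟪v, w⟫ = v 0 * w 0 + v 1 * w 1 := by
  rw [PiLp.inner_apply, Fin.sum_univ_two]; simp [mul_comm]

lemma circ_cone (c : ℝ) (v x : EuclideanSpace ℝ (Fin 2)) (hx : c ≤ x 0 ∧ 0 ≤ x 1) :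
    v ∈ convexNormalCone {p : EuclideanSpace ℝ (Fin 2) | c ≤ p 0 ∧ 0 ≤ p 1} x ↔
      (∀ p, c ≤ p → v 0 * (p - x 0) ≤ 0) ∧ (∀ p, 0 ≤ p → v 1 * (p - x 1) ≤ 0) := by
  constructor
  · intro h
    refine ⟨fun p hp => ?_, fun p hp => ?_⟩
    · have := h (vec2 p (x 1)) ⟨by simpa using hp, by simpa using hx.2⟩
      rw [circ_inner] at this
      simpa using this
    · have := h (vec2 (x 0) p) ⟨by simpa using hx.1, by simpa using hp⟩
      rw [circ_inner] at this
      simpa using this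
  · rintro ⟨h0, h1⟩ y ⟨hy0, hy1⟩
    rw [circ_inner]
    have := h0 _ hy0
    have := h1 _ hy1
    simp only [PiLp.sub_apply]
    linarith

lemma circ_ii_iff {x' : ℝ → EuclideanSpace ℝ (Fin 2)} {a b : ℝ} :
    IntervalIntegrable x' volume a b ↔ ∀ j, IntervalIntegrable (fun t => x' t j) volume a b := by
  constructor
  · intro h j
    exact ⟨(EuclideanSpace.proj j : EuclideanSpace ℝ (Fin 2) →L[ℝ] ℝ).integrable_comp h.1,
      (EuclideanSpace.proj j : EuclideanSpace ℝ (Fin 2) →L[ℝ] ℝ).integrable_comp h.2⟩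
  · intro h
    have e : x' = fun t => ∑ j, x' t j • EuclideanSpace.single j (1 : ℝ) := by
      funext t; ext j; fin_cases j <;> simp [Fin.sum_univ_two]
    rw [e]
    refine ⟨integrable_finsetSum _ fun j _ => (h j).1.smul_const _,
      integrable_finsetSum _ fun j _ => (h j).2.smul_const _⟩

lemma circ_int_apply {x' : ℝ → EuclideanSpace ℝ (Fin 2)} {a b : ℝ}
    (h : IntervalIntegrable x' volume a b) (j : Fin 2) :
    (∫ t in a..b, x' t) j = ∫ t in a..b, x' t j :=
  ((EuclideanSpace.proj j : EuclideanSpace ℝ (Fin 2) →L[ℝ] ℝ).intervalIntegral_comp_comm h).symm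

/-- constant coefficients -/
def circα (R1 R2 L1 L2 : ℝ) : Fin 2 → Fin 2 → ℝ :=
  ![![(R1 + R2) / L1, -(R2 / L1)], ![-(R2 / L2), (R1 + R2) / L2]]

/-- memory coefficients -/
def circβ (L1 L2 : ℝ) (C1 C2 C3 : ℝ → ℝ) (t : ℝ) : Fin 2 → Fin 2 → ℝ :=
  ![![1 / (L1 * C1 t) + 1 / (L1 * C3 t), -(1 / (L1 * C3 t))],
    ![-(1 / (L2 * C3 t)), 1 / (L2 * C2 t) + 1 / (L2 * C3 t)]]

/-- source term -/
def circγ (L1 : ℝ) (C1 i : ℝ → ℝ) (t : ℝ) : Fin 2 → ℝ :=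
  ![1 / (L1 * C1 t) * ∫ s in (0 : ℝ)..t, i s, 0]

lemma circ_bridge {T R1 R2 L1 L2 : ℝ} (hT : 0 ≤ T) {C1 C2 C3 i : ℝ → ℝ}
    (hi : ContinuousOn i (Icc 0 T)) (x x' : ℝ → EuclideanSpace ℝ (Fin 2)) :
    IsCircuitSol T R1 R2 L1 L2 C1 C2 C3 i x x' ↔
      ∀ j, ScalarSol T ((![i, fun _ => 0] : Fin 2 → ℝ → ℝ) j)
        (circDrift (circα R1 R2 L1 L2) (circβ L1 L2 C1 C2 C3) (circγ L1 C1 i)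
          (fun k t => x t k) j) (fun t => x t j) (fun t => x' t j) := by
  have hsub : ∀ t ∈ Icc (0 : ℝ) T, uIcc 0 t ⊆ uIcc 0 T := fun t ht => by
    rw [uIcc_of_le ht.1, uIcc_of_le hT]; exact Icc_subset_Icc_right ht.2
  -- the pointwise inclusion
  have hpt : (∀ j, ContinuousOn (fun t => x t j) (Icc 0 T)) → ∀ t ∈ Icc (0 : ℝ) T, ∀ j,
      (-x' t - vec2 ((R1 + R2) / L1 * x t 0 - R2 / L1 * x t 1)
        (-(R2 / L2) * x t 0 + (R1 + R2) / L2 * x t 1) -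
      ∫ s in (0 : ℝ)..t,
        (vec2 ((1 / (L1 * C1 t) + 1 / (L1 * C3 t)) * x s 0 - 1 / (L1 * C3 t) * x s 1)
            (-(1 / (L2 * C3 t)) * x s 0 + (1 / (L2 * C2 t) + 1 / (L2 * C3 t)) * x s 1) +
          vec2 (i s / (L1 * C1 t)) 0)) j =
      -x' t j - circDrift (circα R1 R2 L1 L2) (circβ L1 L2 C1 C2 C3) (circγ L1 C1 i)
          (fun k t => x t k) j t := by
    intro hx t ht j
    have hii : ∀ f : ℝ → ℝ, ContinuousOn f (Icc 0 T) → IntervalIntegrable f volume 0 t := by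
      intro f hf
      apply ContinuousOn.intervalIntegrable
      rw [uIcc_of_le ht.1]; exact hf.mono (Icc_subset_Icc_right ht.2)
    have h0 := hii _ (hx 0)
    have h1 := hii _ (hx 1)
    have h2 := hii _ hi
    rw [PiLp.sub_apply, circ_int_apply]
    · fin_cases j
      · simp [circDrift, circα, circβ, circγ, Fin.sum_univ_two]
        rw [intervalIntegral.integral_add ((h0.const_mul _).sub (h1.const_mul _)) (h2.div_const _),
          intervalIntegral.integral_sub (h0.const_mul _) (h1.const_mul _),
          intervalIntegral.integral_const_mul, intervalIntegral.integral_const_mul,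
          intervalIntegral.integral_div]
        ring
      · simp [circDrift, circα, circβ, circγ, Fin.sum_univ_two]
        simp_rw [← neg_mul]
        rw [intervalIntegral.integral_add (h0.const_mul _) (h1.const_mul _),
          intervalIntegral.integral_const_mul, intervalIntegral.integral_const_mul]
        ring
    · rw [circ_ii_iff]
      intro j
      fin_cases j
      · simpa using ((h0.const_mul _).sub (h1.const_mul _)).add (h2.div_const _)
      · simpa using (h0.const_mul _).neg.add (h1.const_mul _)
  constructor
  · rintro ⟨s1, s2, s3, s4⟩
    have e1 := circ_ii_iff.1 s1
    have e2 : ∀ j, ∀ t ∈ Icc (0 : ℝ) T, x t j = x 0 j + ∫ s in (0 : ℝ)..t, x' s j := by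
      intro j t ht
      rw [← circ_int_apply (s1.mono_set (hsub t ht)), ← PiLp.add_apply, ← s2 t ht]
    have hc : ∀ j, ContinuousOn (fun t => x t j) (Icc 0 T) := fun j => circ_contOn hT (e1 j) (e2 j)
    refine fun j => ⟨e1 j, e2 j, ?_, ?_⟩
    · intro t ht
      fin_cases j
      · exact (s3 t ht).1
      · exact (s3 t ht).2
    · filter_upwards [s4] with t h ht
      have h5 := (circ_cone _ _ _ (s3 t ht)).1 (h ht)
      rw [hpt hc t ht, hpt hc t ht] at h5
      fin_cases j
      · exact h5.1
      · exact h5.2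
  · intro h
    have s1 : IntervalIntegrable x' volume 0 T := circ_ii_iff.2 fun j => (h j).1
    have hc : ∀ j, ContinuousOn (fun t => x t j) (Icc 0 T) := fun j =>
      circ_contOn hT (h j).1 (h j).2.1
    have s3 : ∀ t ∈ Icc (0 : ℝ) T, i t ≤ x t 0 ∧ 0 ≤ x t 1 := fun t ht =>
      ⟨(h 0).2.2.1 t ht, (h 1).2.2.1 t ht⟩
    refine ⟨s1, ?_, s3, ?_⟩
    · intro t ht
      ext j
      rw [PiLp.add_apply, circ_int_apply (s1.mono_set (hsub t ht))]
      exact (h j).2.1 t ht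
    · filter_upwards [(h 0).2.2.2, (h 1).2.2.2] with t h0 h1 ht
      rw [circ_cone _ _ _ (s3 t ht), hpt hc t ht, hpt hc t ht]
      exact ⟨h0 ht, h1 ht⟩

/-- Proposition 6.1: well-posedness of the non-regular electrical circuit model. -/
theorem circuit_existence_uniqueness
    (T : ℝ) (hT : 0 < T) (R1 R2 : ℝ) (hR1 : 0 ≤ R1) (hR2 : 0 ≤ R2)
    (L1 L2 : ℝ) (hL1 : 0 < L1) (hL2 : 0 < L2)
    (i i' : ℝ → ℝ) (hiint : IntervalIntegrable i' volume 0 T)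
    (hiAC : ∀ t ∈ Icc (0 : ℝ) T, i t = i 0 + ∫ s in (0 : ℝ)..t, i' s)
    (C1 C2 C3 : ℝ → ℝ)
    (hC1 : ContinuousOn C1 (Icc 0 T)) (hC2 : ContinuousOn C2 (Icc 0 T))
    (hC3 : ContinuousOn C3 (Icc 0 T))
    (hC1ne : ∀ t ∈ Icc (0 : ℝ) T, C1 t ≠ 0)
    (hC2ne : ∀ t ∈ Icc (0 : ℝ) T, C2 t ≠ 0)
    (hC3ne : ∀ t ∈ Icc (0 : ℝ) T, C3 t ≠ 0)
    (x0 : EuclideanSpace ℝ (Fin 2)) (hx0 : i 0 ≤ x0 0 ∧ 0 ≤ x0 1) :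
    (∃ x x' : ℝ → EuclideanSpace ℝ (Fin 2),
      x 0 = x0 ∧ IsCircuitSol T R1 R2 L1 L2 C1 C2 C3 i x x') ∧
    (∀ x x' y y' : ℝ → EuclideanSpace ℝ (Fin 2), x 0 = x0 → y 0 = x0 →
      IsCircuitSol T R1 R2 L1 L2 C1 C2 C3 i x x' →
      IsCircuitSol T R1 R2 L1 L2 C1 C2 C3 i y y' →
      ∀ t ∈ Icc (0 : ℝ) T, x t = y t) := by
  have hi : ContinuousOn i (Icc 0 T) := circ_contOn hT.le hiint hiAC
  have hinv : ∀ (L : ℝ) (C : ℝ → ℝ), 0 < L → ContinuousOn C (Icc 0 T) →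
      (∀ t ∈ Icc (0 : ℝ) T, C t ≠ 0) → ContinuousOn (fun t => 1 / (L * C t)) (Icc 0 T) :=
    fun L C hL hC hne => continuousOn_const.div (continuousOn_const.mul hC)
      fun t ht => mul_ne_zero hL.ne' (hne t ht)
  have hβ : ∀ j k, ContinuousOn (fun t => circβ L1 L2 C1 C2 C3 t j k) (Icc 0 T) := by
    intro j k
    fin_cases j <;> fin_cases k
    · exact (hinv L1 C1 hL1 hC1 hC1ne).add (hinv L1 C3 hL1 hC3 hC3ne)
    · exact (hinv L1 C3 hL1 hC3 hC3ne).neg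
    · exact (hinv L2 C3 hL2 hC3 hC3ne).neg
    · exact (hinv L2 C2 hL2 hC2 hC2ne).add (hinv L2 C3 hL2 hC3 hC3ne)
  have hγ : ∀ j, ContinuousOn (fun t => circγ L1 C1 i t j) (Icc 0 T) := by
    intro j
    fin_cases j
    · have h : IntervalIntegrable i volume 0 T := by
        apply ContinuousOn.intervalIntegrable; rwa [uIcc_of_le hT.le]
      have := (h.absolutelyContinuousOnInterval_intervalIntegral (c := 0) (by simp)).continuousOn
      rw [uIcc_of_le hT.le] at this
      exact (hinv L1 C1 hL1 hC1 hC1ne).mul this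
    · exact continuousOn_const
  constructor
  · obtain ⟨a, a', h0, h⟩ := circ_system_exists hT.le (α := circα R1 R2 L1 L2) hβ hγ
      (b := ![i, fun _ => 0]) (b' := ![i', fun _ => 0])
      (by
        intro j
        fin_cases j
        · exact hiint
        · exact intervalIntegrable_const)
      (by
        intro j
        fin_cases j
        · exact hiAC
        · intro t _; simp)
      (fun j => x0 j)
      (by
        intro j
        fin_cases j
        · exact hx0.1
        · exact hx0.2)
    refine ⟨fun t => WithLp.toLp 2 fun j => a j t, fun t => WithLp.toLp 2 fun j => a' j t, ?_, ?_⟩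
    · ext j; exact h0 j
    · rw [circ_bridge hT.le hi]
      exact h
  · intro x x' y y' hx hy hsx hsy t ht
    rw [circ_bridge hT.le hi] at hsx hsy
    ext j
    exact circ_system_unique hT.le hβ (fun k => by rw [hx, hy]) hsx hsy j t ht
end
end

section
/- Let S be a nonempty closed subset of a real Hilbert space H which is r-prox-regular for some r ∈ (0,∞]. Then for every x ∈ H with d_S(x) < r, the set Proj_S(x) := {y ∈ S : ‖x − y‖ = d_S(x)} is nonempty and is a singleton. -/
open MeasureTheory Set
open scoped RealInnerProductSpace ENNReal Pointwise NNReal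

noncomputable section

variable {H : Type*} [NormedAddCommGroup H] [InnerProductSpace ℝ H]

/-- The proximal normal cone of `S` at `x`. -/
def proxNormalCone (S : Set H) (x : H) : Set H :=
  {v | ∃ σ : ℝ, 0 ≤ σ ∧ ∃ δ : ℝ, 0 < δ ∧
    ∀ y ∈ S ∩ Metric.ball x δ, ⟪v, y - x⟫ ≤ σ * ‖y - x‖ ^ 2}

/-- Uniform `r`-prox-regularity, `r ∈ (0, ∞]`. -/
def IsProxRegular (r : ℝ≥0∞) (S : Set H) : Prop :=
  ∀ x ∈ S, ∀ v ∈ proxNormalCone S x, v ≠ 0 →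
    ∀ y ∈ S, ⟪‖v‖⁻¹ • v, y - x⟫ ≤ ((2 * r)⁻¹).toReal * ‖y - x‖ ^ 2

variable [CompleteSpace H]

theorem pow_le_pow_left_aux {a b : ℝ} (h : a ^ 2 ≤ b ^ 2) (hb : 0 ≤ b) : a ≤ b :=
  le_of_not_gt fun hlt => by nlinarith

theorem aux_step (S : Set H) (x y₀ : H) (ε : ℝ) : ∃ y : H, y₀ ∈ S → 0 < ε →
    (y ∈ S ∧ ‖x - y‖ ^ 2 ≤ Metric.infDist x S ^ 2 + ε ∧ ‖x - y‖ ≤ ‖x - y₀‖) := by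
  by_cases hy : y₀ ∈ S
  swap
  · exact ⟨y₀, fun h => absurd h hy⟩
  by_cases hε : 0 < ε
  swap
  · exact ⟨y₀, fun _ h => absurd h hε⟩
  have hd : 0 ≤ Metric.infDist x S := Metric.infDist_nonneg
  have hlt : Metric.infDist x S < Real.sqrt (Metric.infDist x S ^ 2 + ε) := by
    apply Real.lt_sqrt_of_sq_lt
    linarith
  obtain ⟨z, hz, hzd⟩ := (Metric.infDist_lt_iff ⟨y₀, hy⟩).1 hlt
  rw [dist_eq_norm] at hzd
  have hz2 : ‖x - z‖ ^ 2 ≤ Metric.infDist x S ^ 2 + ε := by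
    have := Real.sq_sqrt (show 0 ≤ Metric.infDist x S ^ 2 + ε by positivity)
    have := norm_nonneg (x - z)
    nlinarith
  by_cases h : ‖x - z‖ ≤ ‖x - y₀‖
  · exact ⟨z, fun _ _ => ⟨hz, hz2, h⟩⟩
  · refine ⟨y₀, fun _ _ => ⟨hy, ?_, le_rfl⟩⟩
    push Not at h
    have := norm_nonneg (x - y₀)
    nlinarith

theorem aux_move (x y z : H) (t : ℝ) :
    ‖(x + t • (y - x)) - z‖ ^ 2 =
      (1 - t) * ‖x - z‖ ^ 2 + t * ‖z - y‖ ^ 2 - t * (1 - t) * ‖x - y‖ ^ 2 := by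
  have e1 : (x + t • (y - x)) - z = (x - z) - t • (x - y) := by
    rw [smul_sub, smul_sub]; abel
  have e2 : z - y = (x - y) - (x - z) := by abel
  rw [e1, e2, norm_sub_sq_real (x - z), norm_sub_sq_real (x - y) (x - z), norm_smul, inner_smul_right, mul_pow,
    Real.norm_eq_abs, sq_abs, real_inner_comm (x - z) (x - y)]
  ring

theorem aux_infDist_le (S : Set H) (x y : H) (hy : y ∈ S) : Metric.infDist x S ≤ ‖x - y‖ := by
  rw [← dist_eq_norm]; exact Metric.infDist_le_dist_of_mem hy

theorem aux_dense (S : Set H) (hS : S.Nonempty) (hScl : IsClosed S)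
    (x : H) (δ : ℝ) (hδ : 0 < δ) :
    ∃ x' y : H, y ∈ S ∧ ‖x' - y‖ = Metric.infDist x' S ∧ ‖x - x'‖ ≤ δ := by
  obtain ⟨y₀, hy₀⟩ := hS
  choose g hg using aux_step S
  set M := ‖x - y₀‖ with hM
  have hM0 : 0 ≤ M := norm_nonneg _
  obtain ⟨τ, hτ, hτ1, hτM⟩ : ∃ τ : ℝ, 0 < τ ∧ τ ≤ 1 ∧ 2 * (τ * M) ≤ δ := by
    refine ⟨min 1 (δ / (2 * (M + 1))), by positivity, min_le_left _ _, ?_⟩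
    have h1 : min 1 (δ / (2 * (M + 1))) ≤ δ / (2 * (M + 1)) := min_le_right _ _
    have h2 : δ / (2 * (M + 1)) * (2 * (M + 1)) = δ := by field_simp
    have h3 : 0 < min 1 (δ / (2 * (M + 1))) := by positivity
    nlinarith
  let t : ℕ → ℝ := fun n => τ * (1 / 2) ^ n
  let e : ℕ → ℝ := fun n => τ / 2 * (1 / 8) ^ n
  have ht0 : ∀ n, 0 < t n := fun n => by positivity
  have he0 : ∀ n, 0 < e n := fun n => by positivity
  have hhalf : ∀ n : ℕ, ((1 : ℝ) / 2) ^ n ≤ 1 := fun n =>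
    pow_le_one₀ (by norm_num) (by norm_num)
  have ht1 : ∀ n, t n ≤ 1 := fun n => by
    have := hhalf n
    have h0 : (0 : ℝ) < (1 / 2) ^ n := by positivity
    show τ * (1 / 2) ^ n ≤ 1
    nlinarith
  let p : ℕ → H × H := fun n => Nat.rec (x, g x y₀ (e 0))
    (fun n q => (q.1 + t n • (q.2 - q.1), g (q.1 + t n • (q.2 - q.1)) q.2 (e (n + 1)))) n
  let X : ℕ → H := fun n => (p n).1
  let Y : ℕ → H := fun n => (p n).2
  have hX0 : X 0 = x := rfl
  have hY0 : Y 0 = g x y₀ (e 0) := rfl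
  have hXs : ∀ n, X (n + 1) = X n + t n • (Y n - X n) := fun n => rfl
  have hYs : ∀ n, Y (n + 1) = g (X (n + 1)) (Y n) (e (n + 1)) := fun n => rfl
  have hYS : ∀ n, Y n ∈ S := by
    intro n
    induction n with
    | zero => rw [hY0]; exact (hg _ _ _ hy₀ (he0 0)).1
    | succ n ih => rw [hYs]; exact (hg _ _ _ ih (he0 _)).1
  have hnear : ∀ n, ‖X n - Y n‖ ^ 2 ≤ Metric.infDist (X n) S ^ 2 + e n := by
    intro n
    cases n with
    | zero => rw [hY0, hX0]; exact (hg _ _ _ hy₀ (he0 0)).2.1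
    | succ n => rw [hYs]; exact (hg _ _ _ (hYS n) (he0 _)).2.1
  have hbest : ∀ n, ‖X (n + 1) - Y (n + 1)‖ ≤ ‖X (n + 1) - Y n‖ := by
    intro n
    rw [hYs]; exact (hg _ _ _ (hYS n) (he0 _)).2.2
  have hback : ∀ n, ‖X (n + 1) - Y n‖ = (1 - t n) * ‖X n - Y n‖ := by
    intro n
    have : X (n + 1) - Y n = (1 - t n) • (X n - Y n) := by
      rw [hXs, sub_smul, one_smul, smul_sub, smul_sub]; abel
    rw [this, norm_smul, Real.norm_eq_abs, abs_of_nonneg (by linarith [ht1 n])]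
  have hbound : ∀ n, ‖X n - Y n‖ ≤ M := by
    intro n
    induction n with
    | zero => rw [hY0, hX0]; exact (hg _ _ _ hy₀ (he0 0)).2.2
    | succ n ih =>
      have h1 := hbest n
      rw [hback n] at h1
      have := ht0 n
      have := norm_nonneg (X n - Y n)
      nlinarith
  have hXd : ∀ n, dist (X n) (X (n + 1)) ≤ (τ * M) * (1 / 2) ^ n := by
    intro n
    have : X n - X (n + 1) = t n • (X n - Y n) := by
      rw [hXs, smul_sub, smul_sub]; abel
    rw [dist_eq_norm, this, norm_smul, Real.norm_eq_abs, abs_of_pos (ht0 n)]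
    calc t n * ‖X n - Y n‖ ≤ t n * M := mul_le_mul_of_nonneg_left (hbound n) (ht0 n).le
      _ = _ := by show τ * (1 / 2) ^ n * M = _; ring
  have hYd : ∀ n, dist (Y n) (Y (n + 1)) ≤ 1 * (1 / 2) ^ n := by
    intro n
    have h1 := aux_move (X n) (Y n) (Y (n + 1)) (t n)
    rw [← hXs] at h1
    have h2 := hbest n
    rw [hback n] at h2
    have h3 : ‖X (n + 1) - Y (n + 1)‖ ^ 2 ≤ ((1 - t n) * ‖X n - Y n‖) ^ 2 :=
      pow_le_pow_left₀ (norm_nonneg _) h2 2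
    have h4 := hnear n
    have h5 : Metric.infDist (X n) S ^ 2 ≤ ‖X n - Y (n + 1)‖ ^ 2 :=
      pow_le_pow_left₀ Metric.infDist_nonneg (aux_infDist_le S (X n) (Y (n + 1)) (hYS (n + 1))) 2
    have h6 : t n * ‖Y (n + 1) - Y n‖ ^ 2 ≤
        (1 - t n) * (‖X n - Y n‖ ^ 2 - ‖X n - Y (n + 1)‖ ^ 2) := by linarith
    have h7 : t n * ‖Y (n + 1) - Y n‖ ^ 2 ≤ e n := by
      have := ht1 n
      have := ht0 n
      have := he0 n
      nlinarith
    have h8 : e n ≤ t n * ((1 / 2) ^ n) ^ 2 := by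
      have h9 : ((1 : ℝ) / 8) ^ n = (1 / 2) ^ n * ((1 / 2) ^ n) ^ 2 := by
        rw [← pow_succ', ← pow_mul, mul_comm, pow_mul]; norm_num
      show τ / 2 * (1 / 8) ^ n ≤ τ * (1 / 2) ^ n * ((1 / 2) ^ n) ^ 2
      rw [mul_assoc, ← h9]
      have : (0 : ℝ) < (1 / 8) ^ n := by positivity
      nlinarith
    have h10 : ‖Y (n + 1) - Y n‖ ^ 2 ≤ ((1 / 2 : ℝ) ^ n) ^ 2 :=
      le_of_mul_le_mul_left (h7.trans h8) (ht0 n)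
    rw [dist_comm, dist_eq_norm, one_mul]
    exact pow_le_pow_left_aux h10 (by positivity)
  have hr : (1 / 2 : ℝ) < 1 := by norm_num
  obtain ⟨a, ha⟩ := cauchySeq_tendsto_of_complete (cauchySeq_of_le_geometric _ _ hr hXd)
  obtain ⟨b, hb⟩ := cauchySeq_tendsto_of_complete (cauchySeq_of_le_geometric _ _ hr hYd)
  have hbS : b ∈ S := hScl.mem_of_tendsto hb (Filter.Eventually.of_forall hYS)
  refine ⟨a, b, hbS, le_antisymm ?_ (aux_infDist_le S _ _ hbS), ?_⟩
  · have he : Filter.Tendsto e Filter.atTop (nhds 0) := by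
      have := (tendsto_pow_atTop_nhds_zero_of_lt_one (r := (1 / 8 : ℝ)) (by norm_num)
        (by norm_num)).const_mul (τ / 2)
      simpa [e] using this
    have hc : Filter.Tendsto (fun n => Metric.infDist (X n) S) Filter.atTop
        (nhds (Metric.infDist a S)) :=
      ((Metric.continuous_infDist_pt S).tendsto a).comp ha
    have := le_of_tendsto_of_tendsto' ((ha.sub hb).norm.pow 2) ((hc.pow 2).add he) hnear
    rw [add_zero] at this
    exact pow_le_pow_left_aux this Metric.infDist_nonneg
  · have := dist_le_of_le_geometric_of_tendsto₀ _ _ hr hXd ha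
    rw [hX0, dist_eq_norm] at this
    refine this.trans (le_trans (le_of_eq ?_) hτM)
    ring

theorem aux_normal (r : ℝ≥0∞) (S : Set H) (hreg : IsProxRegular r S) (x y z : H) (hy : y ∈ S)
    (hz : z ∈ S) (h : ‖x - y‖ = Metric.infDist x S) :
    ⟪x - y, z - y⟫ ≤ ((2 * r)⁻¹).toReal * ‖x - y‖ * ‖z - y‖ ^ 2 := by
  by_cases h0 : x - y = 0
  · simp [h0]
  have hmem : x - y ∈ proxNormalCone S y := by
    refine ⟨1 / 2, by norm_num, 1, one_pos, fun w hw => ?_⟩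
    have h1 : ‖x - y‖ ^ 2 ≤ ‖x - w‖ ^ 2 :=
      pow_le_pow_left₀ (norm_nonneg _) (h ▸ aux_infDist_le S x w hw.1) 2
    have e1 : x - w = (x - y) - (w - y) := by abel
    rw [e1, norm_sub_sq_real (x - y)] at h1
    linarith
  have h2 := hreg y hy _ hmem h0 z hz
  rw [real_inner_smul_left] at h2
  have hp : 0 < ‖x - y‖ := norm_pos_iff.2 h0
  have h3 := mul_le_mul_of_nonneg_left h2 hp.le
  rw [mul_inv_cancel_left₀ hp.ne'] at h3
  linarith

theorem aux_mono (r : ℝ≥0∞) (S : Set H) (hreg : IsProxRegular r S) (x y x' y' : H) (q : ℝ)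
    (hy : y ∈ S) (hy' : y' ∈ S) (h : ‖x - y‖ = Metric.infDist x S)
    (h' : ‖x' - y'‖ = Metric.infDist x' S)
    (hq : ((2 * r)⁻¹).toReal * (‖x - y‖ + ‖x' - y'‖) ≤ q) :
    (1 - q) * ‖y - y'‖ ≤ ‖x - x'‖ := by
  by_cases h0 : ‖y - y'‖ = 0
  · rw [h0, mul_zero]; exact norm_nonneg _
  have hp : 0 < ‖y - y'‖ := lt_of_le_of_ne (norm_nonneg _) (Ne.symm h0)
  have h1 := aux_normal r S hreg x y y' hy hy' h
  have h2 := aux_normal r S hreg x' y' y hy' hy h'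
  rw [norm_sub_rev y' y] at h1
  have h3 := real_inner_le_norm (x - x') (y - y')
  have e : ⟪x - x', y - y'⟫ = ‖y - y'‖ ^ 2 - ⟪x - y, y' - y⟫ - ⟪x' - y', y - y'⟫ := by
    rw [← real_inner_self_eq_norm_sq]
    simp only [inner_sub_left, inner_sub_right]
    ring
  have h4 := mul_le_mul_of_nonneg_right hq (sq_nonneg ‖y - y'‖)
  have h5 : ((1 - q) * ‖y - y'‖) * ‖y - y'‖ ≤ ‖x - x'‖ * ‖y - y'‖ := by nlinarith
  exact le_of_mul_le_mul_right h5 hp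

theorem aux_const (r : ℝ≥0∞) (hr : 0 < r) (d : ℝ) (hd0 : 0 ≤ d) (hd : ENNReal.ofReal d < r) :
    2 * ((2 * r)⁻¹).toReal * d < 1 := by
  by_cases h : r = ⊤
  · simp [h]
  have hpos : 0 < r.toReal := ENNReal.toReal_pos hr.ne' h
  have hlt : d < r.toReal := (ENNReal.ofReal_lt_iff_lt_toReal hd0 h).1 hd
  rw [ENNReal.toReal_inv, ENNReal.toReal_mul, ENNReal.toReal_ofNat]
  have : 2 * (2 * r.toReal)⁻¹ * d = d / r.toReal := by field_simp
  rw [this, div_lt_one hpos]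
  exact hlt

/-- Proposition 2.3(b): points close to a prox-regular set have a unique
nearest point. -/
theorem proxRegular_unique_projection (S : Set H) (hS : S.Nonempty) (hScl : IsClosed S)
    (r : ℝ≥0∞) (hr : 0 < r) (hreg : IsProxRegular r S)
    (x : H) (hx : ENNReal.ofReal (Metric.infDist x S) < r) :
    ∃! y : H, y ∈ S ∧ ‖x - y‖ = Metric.infDist x S := by
  set c := ((2 * r)⁻¹).toReal with hc
  have hc0 : 0 ≤ c := ENNReal.toReal_nonneg
  set d := Metric.infDist x S with hd
  have hd0 : 0 ≤ d := Metric.infDist_nonneg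
  have hcd : 2 * c * d < 1 := aux_const r hr d hd0 hx
  obtain ⟨δ, hδ, hq⟩ : ∃ δ : ℝ, 0 < δ ∧ 2 * c * (d + δ) < 1 := by
    refine ⟨(1 - 2 * c * d) / (2 * (2 * c + 1)), div_pos (by linarith) (by positivity), ?_⟩
    have h2 : (1 - 2 * c * d) / (2 * (2 * c + 1)) * (2 * (2 * c + 1)) = 1 - 2 * c * d := by
      field_simp
    have h3 : 0 < (1 - 2 * c * d) / (2 * (2 * c + 1)) := div_pos (by linarith) (by positivity)
    nlinarith
  have hex : ∃ y : H, y ∈ S ∧ ‖x - y‖ = d := by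
    have hden : ∀ n : ℕ, ∃ x' y : H, y ∈ S ∧ ‖x' - y‖ = Metric.infDist x' S ∧
        ‖x - x'‖ ≤ δ * (1 / ((n : ℝ) + 1)) := fun n =>
      aux_dense S hS hScl x _ (by positivity)
    choose X Y hYS hXY hX using hden
    have hXlim : Filter.Tendsto X Filter.atTop (nhds x) := by
      rw [tendsto_iff_norm_sub_tendsto_zero]
      have h1 := (tendsto_one_div_add_atTop_nhds_zero_nat (𝕜 := ℝ)).const_mul δ
      rw [mul_zero] at h1
      refine squeeze_zero (fun _ => norm_nonneg _) (fun n => ?_) h1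
      rw [norm_sub_rev]; exact hX n
    have hXb : ∀ n, ‖X n - Y n‖ ≤ d + δ := by
      intro n
      rw [hXY]
      have h1 : Metric.infDist (X n) S ≤ Metric.infDist x S + dist (X n) x :=
        Metric.infDist_le_infDist_add_dist
      rw [dist_comm, dist_eq_norm] at h1
      have h2 : (1 : ℝ) / ((n : ℝ) + 1) ≤ 1 := by
        rw [div_le_one (by positivity)]
        linarith [Nat.cast_nonneg (α := ℝ) n]
      have := hX n
      nlinarith
    have hmono : ∀ m n, (1 - 2 * c * (d + δ)) * ‖Y m - Y n‖ ≤ ‖X m - X n‖ := by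
      intro m n
      refine aux_mono r S hreg _ _ _ _ _ (hYS m) (hYS n) (hXY m) (hXY n) ?_
      have := mul_le_mul_of_nonneg_left (add_le_add (hXb m) (hXb n)) hc0
      linarith
    have hYc : CauchySeq Y := by
      rw [Metric.cauchySeq_iff]
      intro ε hε
      obtain ⟨N, hN⟩ := Metric.cauchySeq_iff.1 hXlim.cauchySeq
        ((1 - 2 * c * (d + δ)) * ε) (mul_pos (by linarith) hε)
      refine ⟨N, fun m hm n hn => ?_⟩
      have h1 := hN m hm n hn
      rw [dist_eq_norm] at h1 ⊢
      exact lt_of_mul_lt_mul_left ((hmono m n).trans_lt h1) (by linarith)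
    obtain ⟨b, hb⟩ := cauchySeq_tendsto_of_complete hYc
    refine ⟨b, hScl.mem_of_tendsto hb (Filter.Eventually.of_forall hYS), ?_⟩
    have h1 := (hXlim.sub hb).norm
    have h2 : Filter.Tendsto (fun n => Metric.infDist (X n) S) Filter.atTop (nhds d) :=
      ((Metric.continuous_infDist_pt S).tendsto x).comp hXlim
    refine tendsto_nhds_unique h1 (h2.congr fun n => (hXY n).symm)
  obtain ⟨y, hy, hxy⟩ := hex
  refine ⟨y, ⟨hy, hxy⟩, ?_⟩
  rintro z ⟨hz, hxz⟩
  have h1 := aux_mono r S hreg x z x y (2 * c * d) hz hy hxz hxy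
    (by rw [hxz, hxy]; apply le_of_eq; ring)
  rw [sub_self, norm_zero] at h1
  have h2 : ‖z - y‖ ≤ 0 := by
    by_contra hcon
    push Not at hcon
    have := mul_pos (show 0 < 1 - 2 * c * d by linarith) hcon
    linarith
  exact sub_eq_zero.1 (norm_le_zero_iff.1 h2)
end
end
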